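/- The element ω = q a + q^{-1} d is central in 𝒜, and the center of 𝒜 is the polynomial algebra ℂ(q)[ω]; that is, ω is transcendental over ℂ(q) and every central element of 𝒜 is a polynomial in ω with coefficients in ℂ(q). -/

import Mathlib

noncomputable section

abbrev Kq : Type := RatFunc ℂ

/-- The indeterminate `q`. -/
noncomputable def qv : Kq := RatFunc.X

/-- Generators `a`, `b`, `c`, `d` of the algebra `𝒜 = ℒ_{0,1}(sl(2))`. -/
inductive AGen : Type
  | a | b | c | d

/-- The defining relations of `𝒜 = ℒ_{0,1}(sl(2))`. -/
inductive ARel : FreeAlgebra Kq AGen → FreeAlgebra Kq AGen → Prop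
  | ad_comm : ARel (FreeAlgebra.ι Kq AGen.a * FreeAlgebra.ι Kq AGen.d)
      (FreeAlgebra.ι Kq AGen.d * FreeAlgebra.ι Kq AGen.a)
  | db : ARel (FreeAlgebra.ι Kq AGen.d * FreeAlgebra.ι Kq AGen.b)
      ((qv ^ 2) • (FreeAlgebra.ι Kq AGen.b * FreeAlgebra.ι Kq AGen.d))
  | cd : ARel (FreeAlgebra.ι Kq AGen.c * FreeAlgebra.ι Kq AGen.d)
      ((qv ^ 2) • (FreeAlgebra.ι Kq AGen.d * FreeAlgebra.ι Kq AGen.c))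
  | ab : ARel (FreeAlgebra.ι Kq AGen.a * FreeAlgebra.ι Kq AGen.b
        - FreeAlgebra.ι Kq AGen.b * FreeAlgebra.ι Kq AGen.a)
      ((-(1 - qv⁻¹ ^ 2)) • (FreeAlgebra.ι Kq AGen.b * FreeAlgebra.ι Kq AGen.d))
  | cb : ARel (FreeAlgebra.ι Kq AGen.c * FreeAlgebra.ι Kq AGen.b
        - FreeAlgebra.ι Kq AGen.b * FreeAlgebra.ι Kq AGen.c)
      ((1 - qv⁻¹ ^ 2) • (FreeAlgebra.ι Kq AGen.d * FreeAlgebra.ι Kq AGen.a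
        - FreeAlgebra.ι Kq AGen.d * FreeAlgebra.ι Kq AGen.d))
  | ac : ARel (FreeAlgebra.ι Kq AGen.a * FreeAlgebra.ι Kq AGen.c
        - FreeAlgebra.ι Kq AGen.c * FreeAlgebra.ι Kq AGen.a)
      ((1 - qv⁻¹ ^ 2) • (FreeAlgebra.ι Kq AGen.d * FreeAlgebra.ι Kq AGen.c))
  | det : ARel (FreeAlgebra.ι Kq AGen.a * FreeAlgebra.ι Kq AGen.d
        - (qv ^ 2) • (FreeAlgebra.ι Kq AGen.b * FreeAlgebra.ι Kq AGen.c)) 1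

/-- The algebra `𝒜 = ℒ_{0,1}(sl(2))`, presented by generators and relations. -/
abbrev Aalg : Type := RingQuot ARel

noncomputable def aA : Aalg := RingQuot.mkAlgHom Kq ARel (FreeAlgebra.ι Kq AGen.a)
noncomputable def bA : Aalg := RingQuot.mkAlgHom Kq ARel (FreeAlgebra.ι Kq AGen.b)
noncomputable def cA : Aalg := RingQuot.mkAlgHom Kq ARel (FreeAlgebra.ι Kq AGen.c)
noncomputable def dA : Aalg := RingQuot.mkAlgHom Kq ARel (FreeAlgebra.ι Kq AGen.d)

/-- The element `ω = q a + q⁻¹ d`. -/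
noncomputable def ωA : Aalg := qv • aA + qv⁻¹ • dA

open Polynomial

lemma qv_ne_zero : qv ≠ 0 := RatFunc.X_ne_zero

lemma qv_pow_ne_one {m : ℕ} (hm : m ≠ 0) : qv ^ m ≠ 1 := by
  intro h
  have h' : algebraMap ℂ[X] (RatFunc ℂ) (X ^ m) = algebraMap ℂ[X] (RatFunc ℂ) 1 := by
    simpa [qv, RatFunc.algebraMap_X] using h
  have := congrArg natDegree (RatFunc.algebraMap_injective ℂ h')
  simp at this
  exact hm this

lemma qv_zpow_ne_one {m : ℤ} (hm : m ≠ 0) : qv ^ m ≠ 1 := by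
  intro h
  obtain ⟨k, rfl | rfl⟩ := m.eq_nat_or_neg
  · exact qv_pow_ne_one (by simpa using hm) (by simpa using h)
  · exact qv_pow_ne_one (m := k) (by simpa using hm) (by simpa using h)

/-- The canonical `ℕ`-algebra structure, preferred to the one coming from polynomials. -/
instance natAlgebraKq : Algebra ℕ Kq := Semiring.toNatAlgebra

/-- The canonical `ℤ`-algebra structure, preferred to the one coming from polynomials. -/
instance intAlgebraKq : Algebra ℤ Kq := Ring.toIntAlgebra _

/-! ### Relations in the algebra -/

lemma aA_mul_dA : aA * dA = dA * aA := by
  simpa [aA, dA] using RingQuot.mkAlgHom_rel Kq ARel.ad_comm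

lemma dA_mul_bA : dA * bA = qv ^ 2 • (bA * dA) := by
  simpa [bA, dA] using RingQuot.mkAlgHom_rel Kq ARel.db

lemma cA_mul_dA : cA * dA = qv ^ 2 • (dA * cA) := by
  simpa [cA, dA] using RingQuot.mkAlgHom_rel Kq ARel.cd

lemma aA_mul_bA : aA * bA = bA * aA + (-(1 - qv⁻¹ ^ 2)) • (bA * dA) := by
  have := RingQuot.mkAlgHom_rel Kq ARel.ab
  rw [map_sub, map_smul, map_mul, map_mul, map_mul] at this
  exact sub_eq_iff_eq_add'.1 this

lemma cA_mul_bA : cA * bA = bA * cA + (1 - qv⁻¹ ^ 2) • (dA * aA - dA * dA) := by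
  have := RingQuot.mkAlgHom_rel Kq ARel.cb
  rw [map_sub, map_smul, map_sub, map_mul, map_mul, map_mul, map_mul] at this
  exact sub_eq_iff_eq_add'.1 this

lemma aA_mul_cA : aA * cA = cA * aA + (1 - qv⁻¹ ^ 2) • (dA * cA) := by
  have := RingQuot.mkAlgHom_rel Kq ARel.ac
  rw [map_sub, map_smul, map_mul, map_mul, map_mul] at this
  exact sub_eq_iff_eq_add'.1 this

lemma aA_mul_dA_sub : aA * dA - qv ^ 2 • (bA * cA) = 1 := by
  have := RingQuot.mkAlgHom_rel Kq ARel.det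
  rw [map_sub, map_smul, map_mul, map_mul, map_one] at this
  exact this

/-- A subalgebra containing the four generators is everything. -/
lemma mem_of_generators_mem (S : Subalgebra Kq Aalg) (ha : aA ∈ S) (hb : bA ∈ S)
    (hc : cA ∈ S) (hd : dA ∈ S) (x : Aalg) : x ∈ S := by
  obtain ⟨y, rfl⟩ := RingQuot.mkAlgHom_surjective Kq ARel x
  induction y using FreeAlgebra.induction with
  | grade0 r => simp
  | grade1 i => cases i <;> assumption
  | mul u v hu hv => rw [map_mul]; exact S.mul_mem hu hv
  | add u v hu hv => rw [map_add]; exact S.add_mem hu hv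

lemma ωA_mul_bA : ωA * bA = bA * ωA := by
  have h := qv_ne_zero
  simp only [ωA, add_mul, mul_add, smul_mul_assoc, mul_smul_comm, aA_mul_bA, dA_mul_bA]
  match_scalars <;> field_simp <;> ring

lemma ωA_mul_cA : ωA * cA = cA * ωA := by
  have h := qv_ne_zero
  simp only [ωA, add_mul, mul_add, smul_mul_assoc, mul_smul_comm, aA_mul_cA, cA_mul_dA]
  match_scalars <;> field_simp <;> ring

lemma ωA_mul_dA : ωA * dA = dA * ωA := by
  simp only [ωA, add_mul, mul_add, smul_mul_assoc, mul_smul_comm, aA_mul_dA]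

lemma ωA_mul_aA : ωA * aA = aA * ωA := by
  simp only [ωA, add_mul, mul_add, smul_mul_assoc, mul_smul_comm, aA_mul_dA]

lemma ωA_mem_center : ωA ∈ Subalgebra.center Kq Aalg := by
  rw [Subalgebra.mem_center_iff]
  intro x
  have : x ∈ Subalgebra.centralizer Kq {ωA} := by
    apply mem_of_generators_mem <;> rw [Subalgebra.mem_centralizer_iff] <;>
      simp [ωA_mul_aA, ωA_mul_bA, ωA_mul_cA, ωA_mul_dA]
  rw [Subalgebra.mem_centralizer_iff] at this
  exact (this _ rfl).symm

lemma commute_aeval_ωA (w : Kq[X]) (x : Aalg) : Commute (aeval ωA w) x := by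
  have h : aeval ωA w ∈ Subalgebra.center Kq Aalg :=
    Algebra.adjoin_le (Set.singleton_subset_iff.2 ωA_mem_center) (aeval_mem_adjoin_singleton Kq ωA)
  exact ((Subalgebra.mem_center_iff.1 h) x).symm

lemma aA_eq : aA = qv⁻¹ • ωA - qv⁻¹ ^ 2 • dA := by
  have h := qv_ne_zero
  simp only [ωA]
  match_scalars <;> field_simp <;> ring

/-! ### The Cartan part `ℂ(q)[ω][d]` and a spanning family -/

/-- Evaluation at `(ω, d)` of polynomials in `d` with coefficients in `ℂ(q)[ω]`. -/
def evωd : Kq[X][X] →+* Aalg :=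
  eval₂RingHom' (aeval ωA : Kq[X] →ₐ[Kq] Aalg).toRingHom dA fun w => commute_aeval_ωA w dA

@[simp] lemma evωd_C (w : Kq[X]) : evωd (C w) = aeval ωA w := by
  simp [evωd]

@[simp] lemma evωd_X : evωd X = dA := by
  simp [evωd]

/-- The automorphism `d ↦ q ^ (2 * n) d` of `ℂ(q)[ω][d]`. -/
def dScale (n : ℤ) : Kq[X][X] →+* Kq[X][X] := compRingHom (C (C (qv ^ (2 * n))) * X)

@[simp] lemma dScale_C (n : ℤ) (w : Kq[X]) : dScale n (C w) = C w := by
  simp [dScale]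

@[simp] lemma dScale_X (n : ℤ) : dScale n X = C (C (qv ^ (2 * n))) * X := by
  simp [dScale]

lemma coeff_dScale (n : ℤ) (r : Kq[X][X]) (j : ℕ) :
    (dScale n r).coeff j = r.coeff j * C (qv ^ (2 * n * j)) := by
  simp [dScale, comp_C_mul_X_coeff, zpow_mul]

lemma dScale_injective (n : ℤ) : Function.Injective (dScale n) := by
  intro r s h
  ext1 j
  have := congrArg (fun t => t.coeff j) h
  simp only [coeff_dScale] at this
  refine mul_right_cancel₀ ?_ this
  simpa using zpow_ne_zero _ qv_ne_zero

/-- If `x` intertwines `d` with `q ^ (2 * n) d`, then it intertwines all of `ℂ(q)[ω][d]`. -/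
lemma mul_evωd (n : ℤ) {x : Aalg} (hx : x * dA = qv ^ (2 * n) • (dA * x)) (r : Kq[X][X]) :
    x * evωd r = evωd (dScale n r) * x := by
  induction r using Polynomial.induction_on with
  | C w => simpa using (commute_aeval_ωA w x).eq.symm
  | add p r hp hr => simp [mul_add, add_mul, hp, hr]
  | monomial k w h =>
    have hd : x * evωd X = evωd (dScale n X) * x := by
      simp [hx, Algebra.smul_def, mul_assoc]
    rw [pow_succ, ← mul_assoc, map_mul (dScale n) (C w * X ^ k), map_mul evωd (C w * X ^ k),
      map_mul evωd (dScale n _), ← mul_assoc, h, mul_assoc, hd, mul_assoc]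

lemma bA_mul_evωd (r : Kq[X][X]) : bA * evωd r = evωd (dScale (-1) r) * bA := by
  refine mul_evωd _ ?_ r
  have h := qv_ne_zero
  rw [dA_mul_bA, smul_smul, ← zpow_natCast, ← zpow_add₀ h]
  simp

lemma cA_mul_evωd (r : Kq[X][X]) : cA * evωd r = evωd (dScale 1 r) * cA :=
  mul_evωd _ (by rw [cA_mul_dA]; norm_cast) r

lemma C_C_inv_mul : (C (C qv⁻¹) : Kq[X][X]) * C (C qv) = 1 := by
  rw [← C_mul, ← C_mul, inv_mul_cancel₀ qv_ne_zero]; simp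

/-- The element `bc` as a polynomial in `ω` and `d`. -/
def bcPoly : Kq[X][X] :=
  C (C (qv⁻¹ ^ 2)) * (C (C qv⁻¹) * C X * X - C (C (qv⁻¹ ^ 2)) * X ^ 2 - 1)

lemma bA_mul_cA_eq_smul : bA * cA = qv⁻¹ ^ 2 • (aA * dA - 1) := by
  rw [← aA_mul_dA_sub, sub_sub_cancel, smul_smul, ← mul_pow, inv_mul_cancel₀ qv_ne_zero, one_pow,
    one_smul]

lemma bA_mul_cA : bA * cA = evωd bcPoly := by
  rw [bA_mul_cA_eq_smul, aA_eq]
  simp [bcPoly, Algebra.smul_def, sub_mul, mul_assoc, pow_two]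

lemma cA_mul_bA_eq : cA * bA = evωd (dScale 1 bcPoly) := by
  have h := qv_ne_zero
  have h1 : cA * bA = qv⁻¹ • (ωA * dA) - dA * dA - qv⁻¹ ^ 2 • 1 := by
    rw [cA_mul_bA, bA_mul_cA_eq_smul, ← aA_mul_dA, aA_eq]
    simp only [sub_mul, smul_mul_assoc]
    match_scalars <;> field_simp <;> ring
  have h2 : dScale 1 bcPoly = C (C qv⁻¹) * (C X * X) - X * X - C (C (qv⁻¹ ^ 2)) * 1 := by
    have e := C_C_inv_mul
    have e2 : qv ^ (2 * (1 : ℤ)) = qv ^ 2 := by norm_cast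
    simp only [bcPoly, map_mul, map_sub, map_pow, dScale_C, dScale_X, map_one, e2]
    generalize (C (C qv⁻¹) : Kq[X][X]) = y at *
    generalize (C (C qv) : Kq[X][X]) = x at *
    linear_combination (y * C X * X * (y * x + 1) - X ^ 2 * (y * x + 1) * (y ^ 2 * x ^ 2 + 1)) * e
  rw [h1, h2]
  simp [Algebra.smul_def]

/-- The powers `b ^ k` (for `n = k ≥ 0`) and `c ^ k` (for `n = -k < 0`). -/
def bcPow : ℤ → Aalg
  | Int.ofNat k => bA ^ k
  | Int.negSucc k => cA ^ (k + 1)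

/-- The element `∑ i, r i * bcPow i`. -/
def bcSum : (ℤ →₀ Kq[X][X]) →+ Aalg :=
  Finsupp.liftAddHom fun i => (AddMonoidHom.mulRight (bcPow i)).comp evωd.toAddMonoidHom

@[simp] lemma bcSum_single (i : ℤ) (r : Kq[X][X]) :
    bcSum (Finsupp.single i r) = evωd r * bcPow i := by
  simp [bcSum]

lemma mul_bcSum_mem {x : Aalg}
    (h : ∀ (i : ℤ) (r : Kq[X][X]), x * (evωd r * bcPow i) ∈ AddMonoidHom.mrange bcSum)
    {z : Aalg} (hz : z ∈ AddMonoidHom.mrange bcSum) : x * z ∈ AddMonoidHom.mrange bcSum := by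
  obtain ⟨F, rfl⟩ := hz
  induction F using Finsupp.induction_linear with
  | zero => simp
  | add F G hF hG => rw [map_add, mul_add]; exact add_mem hF hG
  | single i r => rw [bcSum_single]; exact h i r

lemma evωd_mul_mem (s : Kq[X][X]) {z : Aalg} (hz : z ∈ AddMonoidHom.mrange bcSum) :
    evωd s * z ∈ AddMonoidHom.mrange bcSum :=
  mul_bcSum_mem (fun i r => ⟨Finsupp.single i (s * r), by rw [bcSum_single, map_mul, mul_assoc]⟩) hz

lemma bcPow_mem (i : ℤ) : bcPow i ∈ AddMonoidHom.mrange bcSum := ⟨Finsupp.single i 1, by simp⟩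

lemma bA_mul_bcPow_mem (i : ℤ) : bA * bcPow i ∈ AddMonoidHom.mrange bcSum := by
  match i with
  | Int.ofNat k =>
    have : bA * bcPow (Int.ofNat k) = bcPow (Int.ofNat (k + 1)) := (pow_succ' bA k).symm
    rw [this]; exact bcPow_mem _
  | Int.negSucc 0 =>
    have : bA * bcPow (Int.negSucc 0) = evωd bcPoly * bcPow (Int.ofNat 0) := by
      simp [bcPow, bA_mul_cA]
    rw [this]; exact evωd_mul_mem _ (bcPow_mem _)
  | Int.negSucc (k + 1) =>
    have : bA * bcPow (Int.negSucc (k + 1)) = evωd bcPoly * bcPow (Int.negSucc k) := by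
      simp only [bcPow]; rw [pow_succ' cA (k + 1), ← mul_assoc, bA_mul_cA]
    rw [this]; exact evωd_mul_mem _ (bcPow_mem _)

lemma cA_mul_bcPow_mem (i : ℤ) : cA * bcPow i ∈ AddMonoidHom.mrange bcSum := by
  match i with
  | Int.ofNat 0 =>
    have : cA * bcPow (Int.ofNat 0) = bcPow (Int.negSucc 0) := by simp [bcPow]
    rw [this]; exact bcPow_mem _
  | Int.ofNat (k + 1) =>
    have : cA * bcPow (Int.ofNat (k + 1)) = evωd (dScale 1 bcPoly) * bcPow (Int.ofNat k) := by
      simp only [bcPow]; rw [pow_succ' bA k, ← mul_assoc, cA_mul_bA_eq]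
    rw [this]; exact evωd_mul_mem _ (bcPow_mem _)
  | Int.negSucc k =>
    have : cA * bcPow (Int.negSucc k) = bcPow (Int.negSucc (k + 1)) := (pow_succ' cA (k + 1)).symm
    rw [this]; exact bcPow_mem _

lemma evωd_mul_of_eq {x : Aalg} (s : Kq[X][X]) (hx : x = evωd s) {z : Aalg}
    (hz : z ∈ AddMonoidHom.mrange bcSum) : x * z ∈ AddMonoidHom.mrange bcSum := hx ▸ evωd_mul_mem s hz

lemma bcSum_surjective : Function.Surjective bcSum := by
  let S : Subalgebra Kq Aalg :=
    { carrier := {x | ∀ z ∈ AddMonoidHom.mrange bcSum, x * z ∈ AddMonoidHom.mrange bcSum}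
      mul_mem' := fun {x y} hx hy z hz => by rw [mul_assoc]; exact hx _ (hy _ hz)
      add_mem' := fun {x y} hx hy z hz => by rw [add_mul]; exact add_mem (hx _ hz) (hy _ hz)
      algebraMap_mem' := fun k z hz => evωd_mul_of_eq (C (C k)) (by simp) hz }
  intro x
  have hx : x ∈ S := by
    apply mem_of_generators_mem
    · refine fun z hz => evωd_mul_of_eq (C (C qv⁻¹ * X) - C (C (qv⁻¹ ^ 2)) * X) ?_ hz
      rw [aA_eq]; simp [Algebra.smul_def]
    · refine fun z hz => mul_bcSum_mem (fun i r => ?_) hz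
      rw [← mul_assoc, bA_mul_evωd, mul_assoc]
      exact evωd_mul_mem _ (bA_mul_bcPow_mem i)
    · refine fun z hz => mul_bcSum_mem (fun i r => ?_) hz
      rw [← mul_assoc, cA_mul_evωd, mul_assoc]
      exact evωd_mul_mem _ (cA_mul_bcPow_mem i)
    · exact fun z hz => evωd_mul_of_eq X evωd_X.symm hz
  simpa [bcPow] using hx (bcPow 0) (bcPow_mem 0)

/-! ### A representation on sequences -/

/-- The operators by which the generators act on sequences in `ℂ(q)[ω][d]`. -/
def genOp : AGen → Module.End Kq[X][X] (ℤ → Kq[X][X])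
  | .a => LinearMap.mulLeft _ fun n => C (C qv⁻¹ * X) - C (C (qv⁻¹ ^ 2)) * dScale n X
  | .b => LinearMap.mulLeft _ (fun n => dScale n bcPoly) ∘ₗ LinearMap.funLeft _ _ (· - 1)
  | .c => LinearMap.funLeft _ _ (· + 1)
  | .d => LinearMap.mulLeft _ fun n => dScale n X

lemma smul_seq_apply (k : Kq) (f : ℤ → Kq[X][X]) (n : ℤ) : (k • f) n = C (C k) * f n := by
  rw [Pi.smul_apply, Algebra.smul_def]; rfl

lemma dScale_succ_X (n : ℤ) : dScale (n + 1) X = C (C qv) ^ 2 * dScale n X := by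
  rw [dScale_X, dScale_X, mul_add, zpow_add₀ qv_ne_zero, ← mul_assoc, ← C_pow, ← C_pow, ← C_mul,
    ← C_mul, mul_comm (qv ^ (2 * n))]
  norm_cast

lemma dScale_bcPoly (n : ℤ) : dScale n bcPoly = C (C qv⁻¹) ^ 2 *
    (C (C qv⁻¹) * C X * dScale n X - C (C qv⁻¹) ^ 2 * dScale n X ^ 2 - 1) := by
  simp only [bcPoly, map_mul, map_sub, map_pow, dScale_C, map_one]

lemma genOp_rel {x y : FreeAlgebra Kq AGen} (h : ARel x y) :
    FreeAlgebra.lift Kq genOp x = FreeAlgebra.lift Kq genOp y := by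
  have e := C_C_inv_mul
  refine LinearMap.ext fun f => funext fun n => ?_
  have e1 := dScale_succ_X n
  have e2 := dScale_succ_X (n - 1)
  have e3 := dScale_bcPoly n
  have e4 := dScale_bcPoly (n + 1)
  rw [sub_add_cancel] at e2
  cases h <;>
    simp only [map_mul, map_sub, map_smul, map_one, FreeAlgebra.lift_ι_apply, genOp,
      Module.End.mul_apply, LinearMap.sub_apply, LinearMap.smul_apply, LinearMap.mulLeft_apply,
      LinearMap.comp_apply, LinearMap.funLeft_apply, Pi.mul_apply, Pi.sub_apply, smul_seq_apply,
      Module.End.one_apply, sub_add_cancel, add_sub_cancel_right, e1, e3, e4, map_pow, map_neg] <;>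
    (try simp only [e2]) <;>
    generalize (C (C qv⁻¹) : Kq[X][X]) = y at * <;>
    generalize (C (C qv) : Kq[X][X]) = x at * <;>
    generalize dScale (n - 1) X = t at * <;>
    clear e1 e2 e3 e4 <;>
    grind

/-- The representation of the algebra on sequences in `ℂ(q)[ω][d]`. -/
def seqRep : Aalg →ₐ[Kq] Module.End Kq[X][X] (ℤ → Kq[X][X]) :=
  RingQuot.liftAlgHom Kq ⟨FreeAlgebra.lift Kq genOp, fun _ _ => genOp_rel⟩

lemma seqRep_mk_ι (i : AGen) :
    seqRep (RingQuot.mkAlgHom Kq ARel (FreeAlgebra.ι Kq i)) = genOp i := by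
  simp [seqRep]

lemma seqRep_dA (f : ℤ → Kq[X][X]) (n : ℤ) : seqRep dA f n = dScale n X * f n := by
  rw [dA, seqRep_mk_ι]; rfl

lemma seqRep_bA (f : ℤ → Kq[X][X]) (n : ℤ) :
    seqRep bA f n = dScale n bcPoly * f (n - 1) := by
  rw [bA, seqRep_mk_ι]; rfl

lemma seqRep_cA (f : ℤ → Kq[X][X]) (n : ℤ) : seqRep cA f n = f (n + 1) := by
  rw [cA, seqRep_mk_ι]; rfl

lemma seqRep_aA (f : ℤ → Kq[X][X]) (n : ℤ) :
    seqRep aA f n = (C (C qv⁻¹ * X) - C (C (qv⁻¹ ^ 2)) * dScale n X) * f n := by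
  rw [aA, seqRep_mk_ι]; rfl

lemma seqRep_ωA (f : ℤ → Kq[X][X]) (n : ℤ) : seqRep ωA f n = C X * f n := by
  have e := C_C_inv_mul
  simp only [ωA, map_add, map_smul, LinearMap.add_apply, LinearMap.smul_apply, Pi.add_apply,
    smul_seq_apply, seqRep_aA, seqRep_dA, map_mul, map_pow]
  linear_combination (C X * f n - C (C qv⁻¹) * dScale n X * f n) * e

lemma seqRep_aeval_ωA (w : Kq[X]) (f : ℤ → Kq[X][X]) (n : ℤ) :
    seqRep (aeval ωA w) f n = C w * f n := by
  induction w using Polynomial.induction_on generalizing f with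
  | C k => rw [aeval_C, AlgHom.commutes]; exact smul_seq_apply k f n
  | add v w hv hw => simp [hv, hw, add_mul]
  | monomial k w h =>
    rw [pow_succ, ← mul_assoc, map_mul, map_mul, Module.End.mul_apply, h, aeval_X, seqRep_ωA,
      map_mul C (C w * X ^ k), mul_assoc]

lemma seqRep_evωd (r : Kq[X][X]) (f : ℤ → Kq[X][X]) (n : ℤ) :
    seqRep (evωd r) f n = dScale n r * f n := by
  induction r using Polynomial.induction_on generalizing f with
  | C w => rw [evωd_C, seqRep_aeval_ωA, dScale_C]
  | add v w hv hw => simp [hv, hw, add_mul]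
  | monomial k w h =>
    rw [pow_succ, ← mul_assoc, map_mul, map_mul, Module.End.mul_apply, h, evωd_X, seqRep_dA,
      map_mul (dScale n) (C w * X ^ k), mul_assoc]

lemma seqRep_bA_single (i : ℤ) (x : Kq[X][X]) :
    seqRep bA (Pi.single i x) = Pi.single (i + 1) (dScale (i + 1) bcPoly * x) := by
  funext n
  rw [seqRep_bA]
  by_cases h : n = i + 1
  · subst h; simp
  · have h' : n - 1 ≠ i := fun h' => h (by omega)
    simp [h, h']

lemma seqRep_cA_single (i : ℤ) (x : Kq[X][X]) :
    seqRep cA (Pi.single i x) = Pi.single (i - 1) x := by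
  funext n
  rw [seqRep_cA]
  by_cases h : n = i - 1
  · subst h; simp
  · have h' : n + 1 ≠ i := fun h' => h (by omega)
    simp [h, h']

lemma dScale_bcPoly_ne_zero (n : ℤ) : dScale n bcPoly ≠ 0 := by
  rw [map_ne_zero_iff _ (dScale_injective n)]
  intro h
  have h0 := congrArg (fun r => r.coeff 0) h
  simp only [bcPoly, coeff_zero, mul_coeff_zero, coeff_sub, coeff_C_zero, coeff_X_zero, mul_zero,
    coeff_one_zero, coeff_X_pow] at h0
  simp [qv_ne_zero] at h0

/-- `bcPow i` maps the `0`th basis sequence to a nonzero multiple of the `i`th one. -/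
lemma exists_seqRep_bcPow_single (i : ℤ) :
    ∃ x ≠ 0, seqRep (bcPow i) (Pi.single 0 1) = Pi.single i x := by
  match i with
  | Int.ofNat k =>
    induction k with
    | zero => exact ⟨1, one_ne_zero, by simp [bcPow]⟩
    | succ k ih =>
      obtain ⟨x, hx, h⟩ := ih
      refine ⟨_, mul_ne_zero (dScale_bcPoly_ne_zero (k + 1)) hx, ?_⟩
      simp only [bcPow] at h ⊢
      rw [pow_succ', map_mul, Module.End.mul_apply, h, seqRep_bA_single]
      rfl
  | Int.negSucc k =>
    refine ⟨1, one_ne_zero, ?_⟩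
    induction k with
    | zero => simp [bcPow, seqRep_cA_single]
    | succ k ih =>
      simp only [bcPow] at ih ⊢
      rw [pow_succ', map_mul, Module.End.mul_apply, ih, seqRep_cA_single]
      rfl

/-- The coefficients of `bcSum F` can be read off from its action on a basis sequence. -/
lemma exists_seqRep_bcSum (i : ℤ) :
    ∃ x ≠ 0, ∀ F, seqRep (bcSum F) (Pi.single 0 1) i = dScale i (F i) * x := by
  obtain ⟨x, hx, h⟩ := exists_seqRep_bcPow_single i
  refine ⟨x, hx, fun F => ?_⟩
  induction F using Finsupp.induction_linear with
  | zero => simp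
  | add F G hF hG => simp [hF, hG, add_mul]
  | single j r =>
    rw [bcSum_single, map_mul, Module.End.mul_apply, seqRep_evωd]
    by_cases hij : j = i
    · subst hij; simp [h]
    · obtain ⟨y, -, hy⟩ := exists_seqRep_bcPow_single j
      simp [hy, Ne.symm hij]

/-! ### The center -/

lemma seqRep_single_eq_zero_of_commute_dA {z : Aalg} (hz : z * dA = dA * z) {i : ℤ} (hi : i ≠ 0) :
    seqRep z (Pi.single 0 1) i = 0 := by
  have hd : seqRep dA (Pi.single 0 1) = (X : Kq[X][X]) • Pi.single 0 1 := by
    funext n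
    rw [seqRep_dA]
    by_cases hn : n = 0
    · subst hn; simp
    · simp [hn]
  have h := congrArg (fun y => seqRep y (Pi.single 0 1) i) hz
  simp only [map_mul, Module.End.mul_apply, hd, map_smul, Pi.smul_apply, smul_eq_mul, seqRep_dA,
    dScale_X] at h
  have h1 : (C (C (qv ^ (2 * i) - 1)) * X) * seqRep z (Pi.single 0 1) i = 0 := by
    simp only [C_sub, C_1]
    linear_combination -h
  refine (mul_eq_zero.1 h1).resolve_left (mul_ne_zero ?_ X_ne_zero)
  rw [Ne, C_eq_zero, C_eq_zero, sub_eq_zero]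
  exact qv_zpow_ne_one (by omega)

lemma dScale_eq_of_commute_bA {r : Kq[X][X]} (h : evωd r * bA = bA * evωd r) :
    dScale 1 r = r := by
  have h := congrArg (fun y => seqRep y (Pi.single 0 1) 1) h
  simp only [map_mul, Module.End.mul_apply, seqRep_bA, seqRep_evωd, sub_self, Pi.single_eq_same,
    mul_one] at h
  have h0 : dScale 0 r = r := by ext1 j; simp [coeff_dScale]
  rw [h0, mul_comm] at h
  exact mul_left_cancel₀ (dScale_bcPoly_ne_zero 1) h

lemma eq_C_of_dScale_eq {r : Kq[X][X]} (h : dScale 1 r = r) : r = C (r.coeff 0) := by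
  ext1 j
  rcases eq_or_ne j 0 with rfl | hj
  · simp
  · rw [coeff_C_of_ne_zero hj]
    have h1 := congrArg (fun s => s.coeff j) h
    simp only [coeff_dScale] at h1
    have h2 : r.coeff j * C (qv ^ (2 * (1 : ℤ) * j) - 1) = 0 := by
      rw [C_sub, C_1]; linear_combination h1
    refine (mul_eq_zero.1 h2).resolve_right ?_
    rw [C_eq_zero, sub_eq_zero]
    exact qv_zpow_ne_one (by omega)

lemma exists_aeval_ωA_eq {z : Aalg} (hz : z ∈ Subalgebra.center Kq Aalg) :
    ∃ w : Kq[X], aeval ωA w = z := by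
  rw [Subalgebra.mem_center_iff] at hz
  obtain ⟨F, rfl⟩ := bcSum_surjective z
  have hF : F = Finsupp.single 0 (F 0) := by
    ext1 i
    rcases eq_or_ne i 0 with rfl | hi
    · simp
    · obtain ⟨x, hx, h⟩ := exists_seqRep_bcSum i
      have h0 := seqRep_single_eq_zero_of_commute_dA (hz dA).symm hi
      rw [h, mul_eq_zero, or_iff_left hx, map_eq_zero_iff _ (dScale_injective i)] at h0
      rw [h0, Finsupp.single_eq_of_ne hi]
  have he : bcSum F = evωd (F 0) := by
    rw [hF]; simp [bcPow]
  rw [he] at hz ⊢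
  refine ⟨(F 0).coeff 0, ?_⟩
  rw [← evωd_C, ← eq_C_of_dScale_eq (dScale_eq_of_commute_bA (hz bA).symm)]

lemma aeval_ωA_injective : Function.Injective (aeval ωA : Kq[X] →ₐ[Kq] Aalg) := by
  intro v w h
  have h := congrArg (fun y => seqRep y 1 0) h
  simpa [seqRep_aeval_ωA] using h

/-- The element `ω = q a + q⁻¹ d` is central in `𝒜`, and the center of `𝒜` is the
polynomial algebra `ℂ(q)[ω]`: `ω` is transcendental over `ℂ(q)` (the evaluation map on
polynomials is injective) and the range of the evaluation map is exactly the center. -/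
theorem statement2 :
    ωA ∈ Subalgebra.center Kq Aalg
    ∧ Function.Injective (Polynomial.aeval ωA : Polynomial Kq →ₐ[Kq] Aalg)
    ∧ (Polynomial.aeval ωA : Polynomial Kq →ₐ[Kq] Aalg).range = Subalgebra.center Kq Aalg := by
  refine ⟨ωA_mem_center, aeval_ωA_injective, le_antisymm ?_ fun z hz => exists_aeval_ωA_eq hz⟩
  rintro _ ⟨w, rfl⟩
  exact Subalgebra.mem_center_iff.2 fun x => (commute_aeval_ωA w x).eq.symm
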